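/- arXiv:1706.06288 — 2 statements merged into one kernel-verified Lean document; each statement's English description precedes it below -/
import Mathlib

section
/- Let H be a real separable Hilbert space, (Ω, 𝓕, P) a probability space, and X_0, ε_1 H-valued random variables with E‖X_0‖²_H < ∞ and E‖ε_1‖²_H < ∞, such that ε_1 is independent of X_0, E[ε_1] = 0, and X_1 := ρ(X_0) + ε_1 for a bounded linear operator ρ on H. Then the cross-covariance operator factorizes through the autocovariance operator: E[X_0 ⊗ X_1] = ρ ∘ E[X_0 ⊗ X_0], i.e., D = ρ ∘ C, where D = E[X_0 ⊗ X_1] and C = E[X_0 ⊗ X_0]. -/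
open MeasureTheory ProbabilityTheory Filter Asymptotics
open scoped RealInnerProductSpace

noncomputable section

/-- The rank-one operator `x ⊗ y : h ↦ ⟪x, h⟫ • y`. -/
def rankOne {H : Type*} [NormedAddCommGroup H] [InnerProductSpace ℝ H] (x y : H) :
    H →L[ℝ] H :=
  (innerSL ℝ x).smulRight y

/-- The rank-one operator as a continuous bilinear map. -/
def rankOneBilin (H : Type*) [NormedAddCommGroup H] [InnerProductSpace ℝ H] :
    H →L[ℝ] H →L[ℝ] H →L[ℝ] H :=
  (ContinuousLinearMap.smulRightL ℝ H H).comp (innerSL ℝ : H →L[ℝ] H →L[ℝ] ℝ)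

theorem rankOne_eq_rankOneBilin {H : Type*} [NormedAddCommGroup H] [InnerProductSpace ℝ H]
    (x y : H) : rankOne x y = rankOneBilin H x y := rfl

theorem rankOne_add_right {H : Type*} [NormedAddCommGroup H] [InnerProductSpace ℝ H]
    (x y z : H) : rankOne x (y + z) = rankOne x y + rankOne x z := by
  simp only [rankOne_eq_rankOneBilin, map_add]

theorem comp_rankOne {H : Type*} [NormedAddCommGroup H] [InnerProductSpace ℝ H]
    (ρ : H →L[ℝ] H) (x y : H) : ρ.comp (rankOne x y) = rankOne x (ρ y) := by
  ext h
  simp [rankOne]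

theorem norm_rankOne {H : Type*} [NormedAddCommGroup H] [InnerProductSpace ℝ H]
    (x y : H) : ‖rankOne x y‖ = ‖x‖ * ‖y‖ := by
  rw [rankOne, ContinuousLinearMap.norm_smulRight_apply, innerSL_apply_norm]

theorem integrable_rankOne_self {Ω H : Type*} [MeasurableSpace Ω]
    [NormedAddCommGroup H] [InnerProductSpace ℝ H] {μ : Measure Ω} {X : Ω → H}
    (hX : AEStronglyMeasurable X μ) (hXsq : Integrable (fun ω => ‖X ω‖ ^ 2) μ) :
    Integrable (fun ω => rankOne (X ω) (X ω)) μ := by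
  refine hXsq.mono' ?_ (.of_forall fun ω => by rw [norm_rankOne, sq])
  simp only [rankOne_eq_rankOneBilin]
  exact (rankOneBilin H).aestronglyMeasurable_comp₂ hX hX

/-- If `X₁ = ρ(X₀) + ε₁` with `ε₁` independent of `X₀` and centred, then the cross-covariance
operator factorizes through the autocovariance operator: `D = ρ ∘ C`. -/
theorem crossCovariance_eq_comp_autocovariance
    {Ω H : Type*} [MeasurableSpace Ω]
    [NormedAddCommGroup H] [InnerProductSpace ℝ H] [CompleteSpace H]
    [TopologicalSpace.SeparableSpace H] [MeasurableSpace H] [BorelSpace H]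
    (μ : Measure Ω) [IsProbabilityMeasure μ]
    (X₀ ε₁ : Ω → H) (ρ : H →L[ℝ] H)
    (hX₀ : Measurable X₀) (hε₁ : Measurable ε₁)
    (hX₀sq : Integrable (fun ω => ‖X₀ ω‖ ^ 2) μ)
    (hε₁sq : Integrable (fun ω => ‖ε₁ ω‖ ^ 2) μ)
    (hindep : IndepFun X₀ ε₁ μ)
    (hmean : ∫ ω, ε₁ ω ∂μ = 0) :
    ∫ ω, rankOne (X₀ ω) (ρ (X₀ ω) + ε₁ ω) ∂μ =
      ρ.comp (∫ ω, rankOne (X₀ ω) (X₀ ω) ∂μ) := by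
  have hX₀int : Integrable X₀ μ :=
    ((memLp_two_iff_integrable_sq_norm hX₀.aestronglyMeasurable).2 hX₀sq).integrable one_le_two
  have hε₁int : Integrable ε₁ μ :=
    ((memLp_two_iff_integrable_sq_norm hε₁.aestronglyMeasurable).2 hε₁sq).integrable one_le_two
  have hC := integrable_rankOne_self hX₀.aestronglyMeasurable hX₀sq
  have hρC : Integrable (fun ω => rankOne (X₀ ω) (ρ (X₀ ω))) μ := by
    simpa only [ContinuousLinearMap.compL_apply, comp_rankOne] using
      (ContinuousLinearMap.compL ℝ H H H ρ).integrable_comp hC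
  have hcross : Integrable (fun ω => rankOne (X₀ ω) (ε₁ ω)) μ :=
    hindep.integrable_bilin hX₀int hε₁int (rankOneBilin H)
  have hzero : ∫ ω, rankOne (X₀ ω) (ε₁ ω) ∂μ = 0 := by
    simp only [rankOne_eq_rankOneBilin]
    rw [hindep.integral_bilin hX₀int hε₁int, hmean, map_zero]
  simp only [rankOne_add_right]
  rw [integral_add hρC hcross, hzero, add_zero]
  simpa only [ContinuousLinearMap.compL_apply, comp_rankOne] using
    (ContinuousLinearMap.compL ℝ H H H ρ).integral_comp_comm hC

end
end

section
/- Let H be a real separable Hilbert space and let A and B be bounded self-adjoint positive operators on H. Suppose (u_j)_{j≥1} is an orthonormal basis of H with A(u_j) = λ_j u_j where λ_1 ≥ λ_2 ≥ … ≥ 0, and (v_j)_{j≥1} is an orthonormal basis of H with B(v_j) = μ_j v_j where μ_1 ≥ μ_2 ≥ … ≥ 0. Then sup_{j≥1} |λ_j − μ_j| ≤ ‖A − B‖_{ℒ(H)}. -/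
open MeasureTheory ProbabilityTheory Filter Asymptotics
open scoped RealInnerProductSpace

noncomputable section

theorem hasSum_sq_inner_of_total
    {H : Type*} [NormedAddCommGroup H] [InnerProductSpace ℝ H] [CompleteSpace H]
    {u : ℕ → H} (hu : Orthonormal ℝ u)
    (hu_total : (Submodule.span ℝ (Set.range u)).topologicalClosure = ⊤) (x : H) :
    HasSum (fun i => ⟪u i, x⟫ ^ 2) (‖x‖ ^ 2) := by
  have h := (HilbertBasis.mk hu hu_total.ge).hasSum_inner_mul_inner x x
  simpa only [HilbertBasis.coe_mk, real_inner_self_eq_norm_sq, real_inner_comm, ← sq] using h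

theorem hasSum_eigenvalue_mul_sq_inner
    {H : Type*} [NormedAddCommGroup H] [InnerProductSpace ℝ H] [CompleteSpace H]
    {A : H →L[ℝ] H} (hA : IsSelfAdjoint A)
    {u : ℕ → H} {lam : ℕ → ℝ} (hu : Orthonormal ℝ u)
    (hu_total : (Submodule.span ℝ (Set.range u)).topologicalClosure = ⊤)
    (hAu : ∀ j, A (u j) = lam j • u j) (x : H) :
    HasSum (fun i => lam i * ⟪u i, x⟫ ^ 2) ⟪A x, x⟫ := by
  have h := (HilbertBasis.mk hu hu_total.ge).hasSum_inner_mul_inner (A x) x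
  refine (funext fun i => ?_ : (fun i => lam i * ⟪u i, x⟫ ^ 2) = _) ▸ h
  have h_symm : ⟪A x, u i⟫ = ⟪x, A (u i)⟫ := hA.isSymmetric x (u i)
  rw [HilbertBasis.coe_mk, h_symm, hAu, real_inner_smul_right, real_inner_comm]
  ring

theorem exists_ne_zero_orthogonal
    {H : Type*} [NormedAddCommGroup H] [InnerProductSpace ℝ H]
    {u : ℕ → H} (hu : Orthonormal ℝ u) (v : ℕ → H) (j : ℕ) :
    ∃ x : H, x ≠ 0 ∧ (∀ i, j < i → ⟪u i, x⟫ = 0) ∧ ∀ i < j, ⟪v i, x⟫ = 0 := by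
  let S := Fintype.linearCombination ℝ (fun i : Fin (j + 1) => u i)
  let T : (Fin (j + 1) → ℝ) →ₗ[ℝ] (Fin j → ℝ) :=
    LinearMap.pi (fun k : Fin j => innerₛₗ ℝ (v k)) ∘ₗ S
  obtain ⟨c, hc, hc0⟩ := (Submodule.ne_bot_iff _).1
    (LinearMap.ker_ne_bot_of_finrank_lt (f := T) (by simp))
  have hli : LinearIndependent ℝ (fun i : Fin (j + 1) => u i) :=
    hu.linearIndependent.comp _ Fin.val_injective
  refine ⟨S c, fun h => hc0 ?_, fun i hi => ?_, fun i hi => ?_⟩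
  · exact funext (Fintype.linearIndependent_iff.1 hli c
      (by simpa [S, Fintype.linearCombination_apply] using h))
  · simp only [S, Fintype.linearCombination_apply, inner_sum, real_inner_smul_right]
    refine Finset.sum_eq_zero fun k _ => ?_
    rw [hu.2 (by have := k.2; omega), mul_zero]
  · exact congrFun (LinearMap.mem_ker.1 hc) ⟨i, hi⟩

/-- One-sided Weyl inequality for self-adjoint operators diagonal in orthonormal bases. -/
theorem eigenvalue_sub_le_norm_sub
    {H : Type*} [NormedAddCommGroup H] [InnerProductSpace ℝ H] [CompleteSpace H]
    {A B : H →L[ℝ] H} (hA : IsSelfAdjoint A)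
    (hB : IsSelfAdjoint B) {u v : ℕ → H} {lam mu : ℕ → ℝ}
    (hu : Orthonormal ℝ u) (hu_total : (Submodule.span ℝ (Set.range u)).topologicalClosure = ⊤)
    (hAu : ∀ j, A (u j) = lam j • u j) (hlam_anti : Antitone lam)
    (hv : Orthonormal ℝ v) (hv_total : (Submodule.span ℝ (Set.range v)).topologicalClosure = ⊤)
    (hBv : ∀ j, B (v j) = mu j • v j) (hmu_anti : Antitone mu) (j : ℕ) :
    lam j - mu j ≤ ‖A - B‖ := by
  obtain ⟨x, hx0, hxu, hxv⟩ := exists_ne_zero_orthogonal hu v j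
  have h_lower : lam j * ‖x‖ ^ 2 ≤ ⟪A x, x⟫ := by
    refine hasSum_le (fun i => ?_) ((hasSum_sq_inner_of_total hu hu_total x).mul_left (lam j))
      (hasSum_eigenvalue_mul_sq_inner hA hu hu_total hAu x)
    rcases le_or_gt i j with hi | hi
    · exact mul_le_mul_of_nonneg_right (hlam_anti hi) (sq_nonneg _)
    · simp [hxu i hi]
  have h_upper : ⟪B x, x⟫ ≤ mu j * ‖x‖ ^ 2 := by
    refine hasSum_le (fun i => ?_) (hasSum_eigenvalue_mul_sq_inner hB hv hv_total hBv x)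
      ((hasSum_sq_inner_of_total hv hv_total x).mul_left (mu j))
    rcases lt_or_ge i j with hi | hi
    · simp [hxv i hi]
    · exact mul_le_mul_of_nonneg_right (hmu_anti hi) (sq_nonneg _)
  have h_norm : ⟪(A - B) x, x⟫ ≤ ‖A - B‖ * ‖x‖ ^ 2 :=
    calc ⟪(A - B) x, x⟫ ≤ ‖(A - B) x‖ * ‖x‖ := real_inner_le_norm _ _
      _ ≤ ‖A - B‖ * ‖x‖ * ‖x‖ := by gcongr; exact (A - B).le_opNorm x
      _ = ‖A - B‖ * ‖x‖ ^ 2 := by ring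
  rw [sub_apply, inner_sub_left] at h_norm
  have hx : 0 < ‖x‖ ^ 2 := by positivity
  refine le_of_mul_le_mul_right ?_ hx
  linarith

/-- Eigenvalue perturbation bound: if `A` and `B` are bounded self-adjoint positive operators
with orthonormal eigenbases and nonincreasing nonnegative eigenvalues `(λ_j)`, `(μ_j)`, then
`sup_j |λ_j − μ_j| ≤ ‖A − B‖`. -/
theorem eigenvalue_perturbation_bound
    {H : Type*} [NormedAddCommGroup H] [InnerProductSpace ℝ H] [CompleteSpace H]
    [TopologicalSpace.SeparableSpace H]
    (A B : H →L[ℝ] H) (hA : IsSelfAdjoint A) (hB : IsSelfAdjoint B)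
    (hApos : ∀ x : H, 0 ≤ ⟪A x, x⟫) (hBpos : ∀ x : H, 0 ≤ ⟪B x, x⟫)
    (u v : ℕ → H) (lam mu : ℕ → ℝ)
    (hu : Orthonormal ℝ u) (hu_total : (Submodule.span ℝ (Set.range u)).topologicalClosure = ⊤)
    (hAu : ∀ j, A (u j) = lam j • u j) (hlam_anti : Antitone lam) (hlam_nonneg : ∀ j, 0 ≤ lam j)
    (hv : Orthonormal ℝ v) (hv_total : (Submodule.span ℝ (Set.range v)).topologicalClosure = ⊤)
    (hBv : ∀ j, B (v j) = mu j • v j) (hmu_anti : Antitone mu) (hmu_nonneg : ∀ j, 0 ≤ mu j) :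
    ∀ j, |lam j - mu j| ≤ ‖A - B‖ := by
  intro j
  rw [abs_sub_le_iff]
  refine ⟨eigenvalue_sub_le_norm_sub hA hB hu hu_total hAu hlam_anti hv hv_total hBv hmu_anti j, ?_⟩
  rw [norm_sub_rev]
  exact eigenvalue_sub_le_norm_sub hB hA hv hv_total hBv hmu_anti hu hu_total hAu hlam_anti j

end
end
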